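/- arXiv:2208.09025 — 2 statements merged into one kernel-verified Lean document; each statement's English description precedes it below -/
import Mathlib

section
/- A prefrieze C of height h over a field 𝕜 is an SL(k)-frieze if and only if the (h+k)-truncated dual C† is a prefrieze of height k. -/
open Finset

variable {K : Type*} [Field K]

/-- The determinant of the square submatrix of the `ℤ×ℤ` matrix `C` with rows indexed
by `I` and columns by `J`, each taken in increasing order (junk value `0` if the
cardinalities differ). -/
noncomputable def minor (C : ℤ → ℤ → K) (I J : Finset ℤ) : K :=
  if h : J.card = I.card then
    Matrix.det (Matrix.of fun i j : Fin I.card =>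
      C (I.orderEmbOfFin rfl i) (J.orderEmbOfFin h j))
  else 0

/-- A prefrieze of height `h`: `C a a = 1` and `C (a+h) a = 1` for all `a`, and
`C a b = 0` whenever `a < b` or `a > b + h`. -/
def IsPrefriezeH (h : ℕ) (C : ℤ → ℤ → K) : Prop :=
  (∀ a : ℤ, C a a = 1) ∧ (∀ a : ℤ, C (a + h) a = 1) ∧
  (∀ a b : ℤ, a < b ∨ b + h < a → C a b = 0)

/-- An `SL(k)`-frieze of height `h`. -/
def IsSLFrieze (k h : ℕ) (C : ℤ → ℤ → K) : Prop :=
  IsPrefriezeH h C ∧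
  (∀ a b : ℤ, b ≤ a → a ≤ b + h →
    minor C (Finset.Icc a (a + k - 1)) (Finset.Icc b (b + k - 1)) = 1) ∧
  (∀ a b : ℤ, b < a → a < b + h →
    minor C (Finset.Icc a (a + k)) (Finset.Icc b (b + k)) = 0)

/-- The `m`-truncated dual `C†` of a prefrieze `C`. -/
noncomputable def truncDual (m : ℕ) (C : ℤ → ℤ → K) : ℤ → ℤ → K :=
  fun a b =>
    if b ≤ a ∧ a < b + m then minor C (Finset.Icc (b + 1) a) (Finset.Icc b (a - 1)) else 0

theorem rot_pow_val (N m : ℕ) (i : Fin N) :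
    (((finRotate N) ^ m) i : Fin N).val = (i.val + m) % N := by
  cases N with
  | zero => exact i.elim0
  | succ n =>
    induction m with
    | zero => simp [Nat.mod_eq_of_lt i.2]
    | succ m ih =>
      rw [pow_succ', Equiv.Perm.mul_apply, finRotate_succ_apply, Fin.val_add, ih]
      simp [add_assoc]

theorem rot_pow_sign (s m : ℕ) :
    Equiv.Perm.sign ((finRotate (s + m)) ^ m) = (-1) ^ (s * m) := by
  rw [map_pow, sign_finRotate, ← pow_mul]
  cases m with
  | zero => simp
  | succ m =>
    have : (s + (m + 1) - 1) * (m + 1) = s * (m + 1) + m * (m + 1) := by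
      rw [← add_assoc, Nat.add_sub_cancel]; ring
    rw [this, pow_add, (Nat.even_mul_succ_self m).neg_one_pow, mul_one]

theorem jacobi_minor (s m : ℕ) (A E : ℕ → ℕ → K)
    (hA : (Matrix.of fun i j : Fin (s + m) => A i j).det = 1)
    (hAE : ∀ i j : ℕ, i < s + m → j < s + m →
      ∑ t : Fin (s + m), A i t * E t j = if i = j then 1 else 0) :
    (Matrix.of fun i j : Fin m => A (s + i) j).det =
      (-1) ^ (s * m) * (Matrix.of fun i j : Fin s => E (m + i) j).det := by
  set ρ : Equiv.Perm (Fin (s + m)) := (finRotate (s + m)) ^ m with hρ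
  set e : Fin s ⊕ Fin m ≃ Fin (s + m) := finSumFinEquiv with he
  have hl : ∀ i : Fin s, (ρ (e (Sum.inl i))).val = m + i := by
    intro i
    rw [hρ, rot_pow_val, he]
    simp only [finSumFinEquiv_apply_left, Fin.val_castAdd]
    rw [Nat.mod_eq_of_lt (by omega)]; omega
  have hr : ∀ i : Fin m, (ρ (e (Sum.inr i))).val = i := by
    intro i
    rw [hρ, rot_pow_val, he]
    simp only [finSumFinEquiv_apply_right, Fin.val_natAdd]
    rw [show s + i.val + m = i.val + (s + m) by omega, Nat.add_mod_right,
      Nat.mod_eq_of_lt (by omega)]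
  have el : ∀ i : Fin s, (e (Sum.inl i)).val = i := fun i => by simp [he]
  have er : ∀ i : Fin m, (e (Sum.inr i)).val = s + i := fun i => by simp [he]
  let W : Matrix (Fin (s + m)) (Fin (s + m)) K := Matrix.of fun i j => A i j
  let M1 : Matrix (Fin s ⊕ Fin m) (Fin s ⊕ Fin m) K :=
    (W.submatrix id ρ).submatrix e e
  let M2 : Matrix (Fin s ⊕ Fin m) (Fin s ⊕ Fin m) K :=
    Matrix.fromBlocks (Matrix.of fun i j : Fin s => E (m + i) j) 0
      (Matrix.of fun (i : Fin m) (j : Fin s) => E i j) 1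
  have h1 : M1.det = (-1) ^ (s * m) := by
    rw [Matrix.det_submatrix_equiv_self, Matrix.det_permute', hA, hρ, rot_pow_sign]
    simp
  have h2 : M2.det = (Matrix.of fun i j : Fin s => E (m + i) j).det := by
    rw [Matrix.det_fromBlocks_zero₁₂, Matrix.det_one, mul_one]
  have hcol : ∀ (p : Fin s ⊕ Fin m) (j : Fin s),
      (M1 * M2) p (Sum.inl j) = if (e p).val = j.val then 1 else 0 := by
    intro p j
    rw [← hAE (e p) j (e p).2 (by omega), Matrix.mul_apply,
      ← Equiv.sum_comp (e.trans ρ) (fun t => A (e p) t * E t j)]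
    refine Finset.sum_congr rfl ?_
    rintro (q | q) -
    · simp [M1, M2, W, hl]
    · simp [M1, M2, W, hr]
  have h3 : M1 * M2 = Matrix.fromBlocks 1 (Matrix.of fun (i : Fin s) (j : Fin m) => A i j) 0
      (Matrix.of fun i j : Fin m => A (s + i) j) := by
    ext p q
    rcases q with j | j
    · rw [hcol]
      rcases p with i | i
      · simp [el, Matrix.one_apply, Fin.ext_iff]
      · simp only [er, Matrix.fromBlocks_apply₂₁, Matrix.zero_apply]
        rw [if_neg (by omega)]
    · rw [Matrix.mul_apply, Fintype.sum_sum_type]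
      rcases p with i | i
      · simp [M1, M2, W, hr, el, Matrix.one_apply]
      · simp [M1, M2, W, hr, er, Matrix.one_apply]
  have h4 := congrArg Matrix.det h3
  rw [Matrix.det_mul, h1, h2, Matrix.det_fromBlocks_zero₂₁, Matrix.det_one, one_mul] at h4
  exact h4.symm

noncomputable def invCol (C : ℤ → ℤ → K) (b : ℤ) (n : ℕ) : K :=
  if n = 0 then 1 else -∑ i : Fin n, C (b + n) (b + i.val) * invCol C b i.val
termination_by n
decreasing_by exact i.2

noncomputable def invMat (C : ℤ → ℤ → K) (a b : ℤ) : K :=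
  if b ≤ a then invCol C b (a - b).toNat else 0

theorem invMat_sum (C : ℤ → ℤ → K) (h1 : ∀ a, C a a = 1) (b : ℤ) (n : ℕ) :
    ∑ t ∈ Finset.range (n + 1), C (b + n) (b + t) * invMat C (b + t) b =
      if n = 0 then 1 else 0 := by
  have hv : ∀ t : ℕ, invMat C (b + t) b = invCol C b t := by
    intro t; simp [invMat]
  simp only [hv]
  rw [Finset.sum_range_succ, h1, one_mul, Finset.sum_range]
  conv_lhs => rw [invCol.eq_def C b n]
  by_cases hn : n = 0
  · subst hn; simp
  · simp [hn]

theorem invMat_mul (C : ℤ → ℤ → K) (h1 : ∀ a, C a a = 1) (h0 : ∀ a b, a < b → C a b = 0)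
    (b : ℤ) (N i j : ℕ) (hi : i < N) :
    ∑ t : Fin N, C (b + i) (b + t.val) * invMat C (b + t.val) (b + j) =
      if i = j then 1 else 0 := by
  rw [← Finset.sum_range (fun t : ℕ => C (b + i) (b + t) * invMat C (b + t) (b + j))]
  have hz : ∀ t : ℕ, (t < j ∨ i < t) → C (b + i) (b + t) * invMat C (b + t) (b + j) = 0 := by
    rintro t (h | h)
    · rw [invMat, if_neg (by omega), mul_zero]
    · rw [h0 _ _ (by omega), zero_mul]
  by_cases hij : i < j
  · rw [if_neg (by omega)]
    exact Finset.sum_eq_zero fun t _ => hz t (by omega)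
  · obtain ⟨n, rfl⟩ := Nat.exists_eq_add_of_le (not_lt.1 hij)
    have := invMat_sum C h1 (b + j) n
    have e2 : (if j + n = j then (1 : K) else 0) = if n = 0 then 1 else 0 := by simp
    rw [e2, ← this]
    symm
    have hinj : Set.InjOn (fun t : ℕ => j + t) (Finset.range (n + 1)) := by
      intro x _ y _ h; simpa using h
    have himg := Finset.sum_image (s := Finset.range (n + 1))
      (f := fun t : ℕ => C (b + (j + n : ℕ)) (b + t) * invMat C (b + t) (b + j)) hinj
    refine Eq.trans ?_ (himg.symm.trans ?_)
    · refine Finset.sum_congr rfl fun t _ => ?_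
      push_cast
      simp only [add_assoc]
    · refine Finset.sum_subset ?_ ?_
      · intro x hx
        simp only [Finset.mem_image, Finset.mem_range] at hx ⊢
        obtain ⟨t, ht, rfl⟩ := hx
        omega
      · intro x _ hx
        apply hz
        by_contra hc
        push Not at hc
        apply hx
        simp only [Finset.mem_image, Finset.mem_range]
        exact ⟨x - j, by omega, by omega⟩

/-- contiguous minor -/
noncomputable def cdet (C : ℤ → ℤ → K) (m : ℕ) (a b : ℤ) : K :=
  (Matrix.of fun i j : Fin m => C (a + i.val) (b + j.val)).det

noncomputable def dualMat (C : ℤ → ℤ → K) (x y : ℤ) : K :=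
  (-1 : K) ^ x * ((-1 : K) ^ y * invMat C x y)

theorem sq_zpow (x : ℤ) : (-1 : K) ^ x * (-1 : K) ^ x = 1 := by
  rw [← zpow_add₀ (by simp)]
  exact (Even.neg_one_zpow ⟨x, rfl⟩)

theorem cdet_dual (C : ℤ → ℤ → K) (h1 : ∀ a, C a a = 1) (h0 : ∀ a b, a < b → C a b = 0)
    (s m : ℕ) (b : ℤ) : cdet C m (b + s) b = cdet (dualMat C) s (b + m) b := by
  have hA : (Matrix.of fun i j : Fin (s + m) => C (b + i.val) (b + j.val)).det = 1 := by
    rw [Matrix.det_of_lowerTriangular]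
    · simp [h1]
    · intro i j hij
      have : i < j := hij
      exact h0 _ _ (by have := Fin.lt_def.1 this; omega)
  have hj := jacobi_minor s m (fun i j => C (b + i) (b + j))
    (fun i j => invMat C (b + i) (b + j)) hA
    (fun i j hi _ => invMat_mul C h1 h0 b (s + m) i j hi)
  have e1 : cdet C m (b + s) b =
      (Matrix.of fun i j : Fin m => C (b + (s + i.val : ℕ)) (b + j.val)).det := by
    simp [cdet, add_assoc]
  rw [e1, hj]
  have e2 : cdet (dualMat C) s (b + m) b = (Matrix.of fun i j : Fin s =>
      (-1 : K) ^ (b + m + i.val) * (Matrix.of fun i j : Fin s => (-1 : K) ^ (b + j.val) *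
        (Matrix.of fun i j : Fin s => invMat C (b + (m + i.val : ℕ)) (b + j.val)) i j) i j).det := by
    simp [cdet, dualMat, add_assoc]
  rw [e2, Matrix.det_mul_column, Matrix.det_mul_row, ← mul_assoc, ← Finset.prod_mul_distrib]
  congr 1
  have : ∀ i : Fin s, (-1 : K) ^ (b + m + i.val) * (-1 : K) ^ (b + i.val) = (-1) ^ m := by
    intro i
    rw [show b + (m : ℤ) + i.val = m + (b + i.val) by ring, zpow_add₀ (by simp), mul_assoc,
      sq_zpow, mul_one, zpow_natCast]
  simp [this, ← pow_mul, mul_comm]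

theorem minor_Icc (C : ℤ → ℤ → K) (m : ℕ) (a b a' b' : ℤ) (ha : a' = a + m - 1)
    (hb : b' = b + m - 1) : minor C (Finset.Icc a a') (Finset.Icc b b') = cdet C m a b := by
  subst ha hb
  have ca : (Finset.Icc a (a + m - 1)).card = m := by simp
  have cb : (Finset.Icc b (b + m - 1)).card = m := by simp
  have key : ∀ (I J : Finset ℤ) (hI : I.card = m) (hJ : J.card = m), minor C I J =
      (Matrix.of fun i j : Fin m => C (I.orderEmbOfFin hI i) (J.orderEmbOfFin hJ j)).det := by
    intro I J hI hJ
    subst hI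
    simp [minor, hJ]
  have emb : ∀ (c : ℤ) (hc : (Finset.Icc c (c + m - 1)).card = m) (i : Fin m),
      (Finset.Icc c (c + m - 1)).orderEmbOfFin hc i = c + i.val := by
    intro c hc i
    have := Finset.orderEmbOfFin_unique hc (f := fun i : Fin m => c + i.val)
      (fun x => by simp only [Finset.mem_Icc]; omega)
      (fun x y hxy => by have := Fin.lt_def.1 hxy; simp only; omega)
    exact (congrFun this i).symm
  rw [key _ _ ca cb, cdet]
  simp only [emb]

theorem truncDual_eq (C : ℤ → ℤ → K) (h1 : ∀ a, C a a = 1) (h0 : ∀ a b, a < b → C a b = 0)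
    (M m : ℕ) (b : ℤ) (hm : m < M) : truncDual M C (b + m) b = dualMat C (b + m) b := by
  rw [truncDual, if_pos ⟨by omega, by omega⟩,
    minor_Icc C m (b + 1) b _ _ (by ring) (by ring)]
  have := cdet_dual C h1 h0 1 m b
  rw [Nat.cast_one] at this
  rw [this]
  simp [cdet]

theorem cdet_upper (D : ℤ → ℤ → K) (s : ℕ) (a b : ℤ) (c : K)
    (hd : ∀ i : ℕ, i < s → D (a + i) (b + i) = c)
    (hl : ∀ i j : ℕ, j < i → i < s → D (a + i) (b + j) = 0) : cdet D s a b = c ^ s := by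
  rw [cdet, Matrix.det_of_upperTriangular]
  · simp [hd]
  · intro i j hij
    have h : j < i := hij
    exact hl _ _ (Fin.lt_def.1 h) i.2

theorem cdet_corner (D : ℤ → ℤ → K) (r : ℕ) (a b : ℤ)
    (h0 : ∀ i : ℕ, i < r → D (a + i) b = 0)
    (hd : ∀ i : ℕ, i < r → D (a + i) (b + 1 + i) = 1)
    (hl : ∀ i j : ℕ, j < i → i < r → D (a + i) (b + 1 + j) = 0) :
    cdet D (r + 1) a b = (-1) ^ r * D (a + r) b := by
  rw [cdet, Matrix.det_succ_column_zero, Finset.sum_eq_single (Fin.last r)]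
  · have h := cdet_upper D r a (b + 1) 1 hd hl
    rw [one_pow] at h
    have h' : ((Matrix.of fun i j : Fin (r + 1) => D (a + i.val) (b + j.val)).submatrix
        (Fin.last r).succAbove Fin.succ).det = 1 := by
      rw [← h, cdet]
      congr 1
      ext i j
      simp only [Fin.succAbove_last, Matrix.submatrix_apply, Matrix.of_apply, Fin.val_castSucc,
        Fin.val_succ]
      congr 1; push_cast; ring
    rw [h']
    simp
  · intro i _ hi
    have : i.val < r := by
      have := Fin.val_lt_last hi
      simpa using this
    simp [h0 i.val this]
  · simp

/-- **Dual characterization of `SL(k)`-friezes.** A prefrieze `C` of height `h` is an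
`SL(k)`-frieze iff its `(h+k)`-truncated dual `C†` is a prefrieze of height `k`. -/
theorem slFrieze_iff_truncDual_prefrieze (k h : ℕ) (hk : 0 < k) (hh : 0 < h)
    (C : ℤ → ℤ → K) (hC : IsPrefriezeH h C) :
    IsSLFrieze k h C ↔ IsPrefriezeH k (truncDual (h + k) C) := by
  obtain ⟨c1, c2, c3⟩ := hC
  have h0 : ∀ a b, a < b → C a b = 0 := fun a b h => c3 a b (Or.inl h)
  have hT : ∀ (m : ℕ) (b : ℤ), m < h + k → truncDual (h + k) C (b + m) b = dualMat C (b + m) b :=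
    fun m b hm => truncDual_eq C c1 h0 (h + k) m b hm
  have hdual : ∀ (m : ℕ) (a b : ℤ) (s : ℕ), a = b + s →
      cdet C m a b = cdet (dualMat C) s (b + m) b := by
    rintro m a b s rfl; exact cdet_dual C c1 h0 s m b
  have m1 : ∀ a b : ℤ, minor C (Finset.Icc a (a + k - 1)) (Finset.Icc b (b + k - 1)) =
      cdet C k a b := fun a b => minor_Icc C k a b _ _ rfl rfl
  have m2 : ∀ a b : ℤ, minor C (Finset.Icc a (a + k)) (Finset.Icc b (b + k)) =
      cdet C (k + 1) a b := fun a b =>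
    minor_Icc C (k + 1) a b _ _ (by push_cast; ring) (by push_cast; ring)
  constructor
  · rintro ⟨-, f1, f2⟩
    have d1 : ∀ b : ℤ, dualMat C (b + k) b = 1 := by
      intro b
      have := f1 (b + 1) b (by omega) (by omega)
      rw [m1, hdual k (b + 1) b 1 (by simp)] at this
      simpa [cdet] using this
    have d2 : ∀ r : ℕ, r + 1 < h → ∀ b : ℤ, dualMat C (b + k + 1 + r) b = 0 := by
      intro r
      induction r using Nat.strong_induction_on with
      | _ r ih =>
        intro hr b
        have := f2 (b + (r + 1 : ℕ)) b (by push_cast; omega) (by push_cast; omega)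
        rw [m2, hdual (k + 1) _ b (r + 1) rfl, cdet_corner] at this
        · have h2 : (-1 : K) ^ r ≠ 0 := by simp
          have h3 := (mul_eq_zero.1 this).resolve_left h2
          rw [← h3]; push_cast; congr 1; ring
        · intro i hi
          rw [← ih i hi (by omega) b]; push_cast; congr 1; ring
        · intro i hi
          rw [← d1 (b + 1 + i)]; push_cast; congr 1; ring
        · intro i j hji hi
          rw [← ih (i - j - 1) (by omega) (by omega) (b + 1 + j)]; congr 1; push_cast; omega
    refine ⟨?_, ?_, ?_⟩
    · intro a
      have := hT 0 a (by omega)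
      simp only [Nat.cast_zero, add_zero] at this
      rw [this]
      simp [dualMat, invMat, invCol, sq_zpow]
    · intro a
      rw [hT k a (by omega), d1]
    · rintro a b hab
      by_cases hc : b ≤ a ∧ a < b + (h + k : ℕ)
      · have e : a = b + k + 1 + ((a - b - k - 1).toNat : ℕ) := by omega
        have e' : a = b + ((a - b).toNat : ℕ) := by omega
        rw [e', hT _ _ (by omega), ← e']
        rw [e]
        apply d2
        push_cast at hc
        omega
      · rw [truncDual, if_neg hc]
  · rintro ⟨-, t2, t3⟩
    have d1 : ∀ b : ℤ, dualMat C (b + k) b = 1 := by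
      intro b
      rw [← hT k b (by omega), t2]
    have d2 : ∀ a b : ℤ, b + k < a → a < b + k + h → dualMat C a b = 0 := by
      intro a b hab hab'
      have e' : a = b + ((a - b).toNat : ℕ) := by omega
      rw [e', ← hT _ _ (by omega), ← e']
      exact t3 a b (Or.inr hab)
    refine ⟨⟨c1, c2, c3⟩, ?_, ?_⟩
    · intro a b hab hab'
      rw [m1, hdual k a b (a - b).toNat (by omega), cdet_upper _ _ _ _ 1, one_pow]
      · intro i hi
        rw [← d1 (b + i)]; congr 1; ring
      · intro i j hji hi
        exact d2 _ _ (by omega) (by omega)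
    · intro a b hab hab'
      rw [m2, hdual (k + 1) a b (a - b).toNat (by omega), cdet_upper _ _ _ _ 0,
        zero_pow (by omega)]
      · intro i hi
        exact d2 _ _ (by push_cast; omega) (by push_cast; omega)
      · intro i j hji hi
        exact d2 _ _ (by push_cast; omega) (by push_cast; omega)
end

section
/- A prefrieze C of height h over a field 𝕜 is an SL(k)-frieze if and only if every sequence x : ℤ → 𝕜 satisfying Cx = 0 satisfies x_{a+h+k} = (−1)^{k−1}·x_a for all a ∈ ℤ. -/
open Finset

variable {K : Type*} [Field K]

/-- The sequence `x : ℤ → K` solves the linear recurrence `C x = 0`: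
each row of `C` has finitely many nonzero entries, and the (finite) sum
`∑_b C a b * x b` vanishes for every `a`. -/
def SolvesRec (C : ℤ → ℤ → K) (x : ℤ → K) : Prop :=
  ∀ a : ℤ, ∑ᶠ b : ℤ, C a b * x b = 0

noncomputable def wdet (C : ℤ → ℤ → K) (k : ℕ) (a b : ℤ) : K :=
  Matrix.det (Matrix.of fun i j : Fin k => C (a + ((i : ℕ) : ℤ)) (b + ((j : ℕ) : ℤ)))

theorem minor_eq_aux (C : ℤ → ℤ → K) (k : ℕ) (I J : Finset ℤ) (hI : I.card = k)
    (hJ : J.card = k) : minor C I J =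
      Matrix.det (Matrix.of fun i j : Fin k =>
        C (I.orderEmbOfFin hI i) (J.orderEmbOfFin hJ j)) := by
  subst hI
  simp only [minor, hJ, dif_pos]

theorem emb_aux (a b : ℤ) (k : ℕ) (hab : b = a + k - 1) (hI : (Finset.Icc a b).card = k)
    (i : Fin k) : (Finset.Icc a b).orderEmbOfFin hI i = a + ((i : ℕ) : ℤ) := by
  have := Finset.orderEmbOfFin_unique (s := Finset.Icc a b) hI
    (f := fun i : Fin k => a + ((i : ℕ) : ℤ))
    (by intro x; have := x.2; simp only [Finset.mem_Icc]; omega)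
    (by intro x y hxy; have : (x : ℕ) < y := hxy; simp only; omega)
  exact (congrFun this i).symm

theorem minor_eq_wdet (C : ℤ → ℤ → K) (k : ℕ) (a b : ℤ) :
    minor C (Finset.Icc a (a + k - 1)) (Finset.Icc b (b + k - 1)) = wdet C k a b := by
  rw [minor_eq_aux C k _ _ (by simp) (by simp)]
  unfold wdet
  congr 1
  ext i j
  simp only [Matrix.of_apply]
  rw [emb_aux a _ k rfl, emb_aux b _ k rfl]

theorem minor_eq_wdet' (C : ℤ → ℤ → K) (k : ℕ) (a b : ℤ) :
    minor C (Finset.Icc a (a + k)) (Finset.Icc b (b + k)) = wdet C (k + 1) a b := by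
  rw [← minor_eq_wdet]
  congr 2 <;> push_cast <;> ring

theorem relA {k : ℕ} (R : Fin (k + 1) → Fin k → K) (d : Fin (k + 1) → K) (hd : d ≠ 0)
    (h : ∀ j, ∑ i, d i * R i j = 0) :
    d (Fin.last k) * Matrix.det (Matrix.of fun i j : Fin k => R i.succ j) =
      (-1) ^ k * d 0 * Matrix.det (Matrix.of fun i j : Fin k => R i.castSucc j) := by
  let u : Fin (k + 1) → K := fun i =>
    (if i = 0 then d (Fin.last k) else 0) - (if i = Fin.last k then d 0 else 0)
  let N : Matrix (Fin (k + 1)) (Fin (k + 1)) K := Matrix.of fun i => Fin.cons (u i) (R i)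
  have hN : N.det = 0 := by
    rw [← Matrix.exists_vecMul_eq_zero_iff]
    refine ⟨d, hd, ?_⟩
    ext j
    simp only [Matrix.vecMul, dotProduct, N, Matrix.of_apply, Pi.zero_apply]
    refine Fin.cases ?_ (fun j => ?_) j
    · simp [u, mul_sub, Finset.sum_sub_distrib]
      ring
    · simpa using h j
  rw [Matrix.det_succ_column_zero] at hN
  have e0 : N.submatrix (Fin.succAbove 0) Fin.succ =
      Matrix.of fun i j : Fin k => R i.succ j := by
    ext i j; simp [N]
  have e1 : N.submatrix (Fin.succAbove (Fin.last k)) Fin.succ =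
      Matrix.of fun i j : Fin k => R i.castSucc j := by
    ext i j; simp [N]
  have hN0 : ∀ i, N i 0 = u i := fun i => rfl
  simp only [hN0, u, mul_sub, sub_mul, Finset.sum_sub_distrib, mul_ite, ite_mul, mul_zero,
    zero_mul, Finset.sum_ite_eq', Finset.sum_ite_eq, Finset.mem_univ, if_true, e0, e1] at hN
  simp at hN
  linear_combination hN

theorem relB {k : ℕ} (R : Fin (k + 1) → Fin k → K) (d : Fin (k + 1) → K) (h0 : d 0 = 0)
    (h : ∀ j, ∑ i, d i * R i j = 0)
    (hdet : Matrix.det (Matrix.of fun i j : Fin k => R i.succ j) ≠ 0) : d = 0 := by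
  have : (fun i : Fin k => d i.succ) = 0 := by
    apply Matrix.eq_zero_of_vecMul_eq_zero hdet
    ext j
    have := h j
    rw [Fin.sum_univ_succ, h0] at this
    simpa [Matrix.vecMul, dotProduct] using this
  ext i
  refine Fin.cases h0 (fun i => congrFun this i) i

theorem row_sum {h : ℕ} {C : ℤ → ℤ → K} (hC : IsPrefriezeH h C) (x : ℤ → K) (s lo hi : ℤ)
    (h1 : lo ≤ s - h) (h2 : s ≤ hi) :
    ∑ᶠ b : ℤ, C s b * x b = ∑ b ∈ Finset.Icc lo hi, C s b * x b := by
  apply finsum_eq_sum_of_support_subset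
  intro b hb
  simp only [Finset.coe_Icc, Set.mem_Icc]
  by_contra hcon
  apply hb
  have : C s b = 0 := hC.2.2 s b (by omega)
  simp [this]

noncomputable def recSol (h : ℕ) (c : ℕ → ℕ → K) (u : ℕ → K) (n : ℕ) : K :=
  if hn : n < h then u n
  else ∑ j : Fin h, c (n - h) j * recSol h c u (n - h + j)
termination_by n
decreasing_by have := j.2; omega

theorem recSol_init (h : ℕ) (c : ℕ → ℕ → K) (u : ℕ → K) (n : ℕ) (hn : n < h) :
    recSol h c u n = u n := by
  rw [recSol]; simp [hn]

theorem recSol_step (h : ℕ) (c : ℕ → ℕ → K) (u : ℕ → K) (n : ℕ) :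
    recSol h c u (n + h) = ∑ j ∈ Finset.range h, c n j * recSol h c u (n + j) := by
  rw [recSol]; simp [Finset.sum_range]

theorem sum_Icc_fwd (f : ℤ → K) (s : ℤ) (h : ℕ) :
    ∑ b ∈ Finset.Icc (s - h) s, f b = ∑ j ∈ Finset.range (h + 1), f (s - h + j) := by
  symm
  apply Finset.sum_bij (fun (j : ℕ) _ => s - h + (j : ℤ))
  · intro j hj; simp only [Finset.mem_range] at hj; simp only [Finset.mem_Icc]; omega
  · intro i _ j _ hij; omega
  · intro b hb
    simp only [Finset.mem_Icc] at hb
    exact ⟨(b - (s - h)).toNat, by simp only [Finset.mem_range]; omega, by omega⟩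
  · intros; rfl

theorem sum_Icc_bwd (f : ℤ → K) (s : ℤ) (h : ℕ) :
    ∑ b ∈ Finset.Icc (s - h) s, f b = ∑ j ∈ Finset.range (h + 1), f (s - j) := by
  symm
  apply Finset.sum_bij (fun (j : ℕ) _ => s - (j : ℤ))
  · intro j hj; simp only [Finset.mem_range] at hj; simp only [Finset.mem_Icc]; omega
  · intro i _ j _ hij; omega
  · intro b hb
    simp only [Finset.mem_Icc] at hb
    exact ⟨(s - b).toNat, by simp only [Finset.mem_range]; omega, by omega⟩
  · intros; rfl

theorem exists_sol {h : ℕ} {C : ℤ → ℤ → K} (hC : IsPrefriezeH h C) (a : ℤ) (y : ℤ → K) :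
    ∃ x, SolvesRec C x ∧ ∀ c, a - h ≤ c → c < a → x c = y c := by
  let f := recSol h (fun n j => - C (a + n) (a + n - h + j)) (fun n => y (a - h + n))
  let g := recSol h (fun n j => - C (a - 1 - n) (a - 1 - n - j)) (fun n => y (a - 1 - n))
  let x : ℤ → K := fun t => if a - h ≤ t then f (t - (a - h)).toNat else g (a - 1 - t).toNat
  have hinit : ∀ c, a - h ≤ c → c < a → x c = y c := by
    intro c h1 h2
    simp only [x, h1, if_true]
    simp only [f]
    rw [recSol_init _ _ _ _ (by omega)]
    congr 1; omega
  have hxf : ∀ n : ℕ, x (a - h + n) = f n := by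
    intro n
    simp only [x]
    rw [if_pos (by omega)]
    congr 1; omega
  have hxg : ∀ n : ℕ, x (a - 1 - n) = g n := by
    intro n
    by_cases hn : n < h
    · rw [hinit _ (by omega) (by omega)]
      simp only [g]
      rw [recSol_init _ _ _ _ hn]
    · simp only [x]
      rw [if_neg (by omega)]
      congr 1; omega
  refine ⟨x, ?_, hinit⟩
  intro s
  rw [row_sum hC x s (s - h) s le_rfl le_rfl]
  by_cases hs : a ≤ s
  · obtain ⟨n, rfl⟩ : ∃ n : ℕ, s = a + n := ⟨(s - a).toNat, by omega⟩
    rw [sum_Icc_fwd, Finset.sum_range_succ]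
    have e : ∀ j : ℕ, x (a + n - h + j) = f (n + j) := by
      intro j; rw [← hxf]; congr 1; push_cast; ring
    simp only [e]
    have := recSol_step h (fun n j => - C (a + n) (a + n - h + j)) (fun n => y (a - h + n)) n
    change f (n + h) = ∑ j ∈ Finset.range h, _ * f (n + j) at this
    rw [this]
    have h1 : (a + n - h + h : ℤ) = a + n := by ring
    rw [h1, hC.1]
    simp
  · obtain ⟨n, hn⟩ : ∃ n : ℕ, s = a - 1 - n := ⟨(a - 1 - s).toNat, by omega⟩
    subst hn
    rw [sum_Icc_bwd, Finset.sum_range_succ]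
    have e : ∀ j : ℕ, x (a - 1 - n - j) = g (n + j) := by
      intro j; rw [← hxg]; congr 1; push_cast; ring
    simp only [e]
    have := recSol_step h (fun n j => - C (a - 1 - n) (a - 1 - n - j)) (fun n => y (a - 1 - n)) n
    change g (n + h) = ∑ j ∈ Finset.range h, _ * g (n + j) at this
    rw [this]
    have h1 : C (a - 1 - n) (a - 1 - n - h) = 1 := by
      have := hC.2.1 (a - 1 - n - h)
      rwa [sub_add_cancel] at this
    rw [h1]
    simp

/-- a linear relation among rows `a..a+k` of `C` on the inner columns. -/
def Killer (C : ℤ → ℤ → K) (k h : ℕ) (a : ℤ) (d : Fin (k + 1) → K) : Prop :=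
  d 0 = (-1) ^ k ∧ d (Fin.last k) = 1 ∧
    ∀ c : ℤ, a - h < c → c < a + k → ∑ i : Fin (k + 1), d i * C (a + ((i : ℕ) : ℤ)) c = 0

theorem wdet_diag {h : ℕ} {C : ℤ → ℤ → K} (hC : IsPrefriezeH h C) (k : ℕ) (a : ℤ) :
    wdet C k a a = 1 := by
  unfold wdet
  rw [Matrix.det_of_lowerTriangular]
  · simp [hC.1]
  · intro i j hij
    have : (i : ℕ) < j := hij
    exact hC.2.2 _ _ (by omega)

theorem wdet_succ_row (C : ℤ → ℤ → K) (k : ℕ) (a b : ℤ) :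
    wdet C k (a + 1) b = Matrix.det (Matrix.of fun i j : Fin k =>
      (fun (i : Fin (k + 1)) (j : Fin k) => C (a + ((i : ℕ) : ℤ)) (b + ((j : ℕ) : ℤ)))
        i.succ j) := by
  unfold wdet
  congr 1
  ext i j
  simp only [Matrix.of_apply, Fin.val_succ]
  congr 1
  push_cast; ring

theorem end_cols {k h : ℕ} {C : ℤ → ℤ → K} (hC : IsPrefriezeH h C) (d : Fin (k + 1) → K)
    (a : ℤ) (hk : 0 < k) (hh : 0 < h) :
    ∑ i : Fin (k + 1), d i * C (a + ((i : ℕ) : ℤ)) (a - h) = d 0 ∧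
    ∑ i : Fin (k + 1), d i * C (a + ((i : ℕ) : ℤ)) (a + k) = d (Fin.last k) := by
  constructor
  · rw [Finset.sum_eq_single 0]
    · have := hC.2.1 (a - h)
      rw [sub_add_cancel] at this
      simp [this]
    · intro i _ hi
      have : (i : ℕ) ≠ 0 := fun h => hi (Fin.ext h)
      rw [hC.2.2 _ _ (by omega), mul_zero]
    · simp
  · rw [Finset.sum_eq_single (Fin.last k)]
    · simp [hC.1]
    · intro i _ hi
      have : (i : ℕ) ≠ k := fun h => hi (Fin.ext h)
      have := i.2
      rw [hC.2.2 _ _ (by omega), mul_zero]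
    · simp

theorem killer_of_frieze {k h : ℕ} (hh : 0 < h) {C : ℤ → ℤ → K}
    (hF : ∀ a b : ℤ, b ≤ a → a ≤ b + h → wdet C k a b = 1)
    (hF' : ∀ a b : ℤ, b < a → a < b + h → wdet C (k + 1) a b = 0) (a : ℤ) :
    ∃ d, Killer C k h a d := by
  let R : ℤ → Fin (k + 1) → Fin k → K :=
    fun b i j => C (a + ((i : ℕ) : ℤ)) (b + ((j : ℕ) : ℤ))
  have hbot : ∀ b, b ≤ a + 1 → a + 1 ≤ b + h →
      Matrix.det (Matrix.of fun i j : Fin k => R b i.succ j) = 1 := by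
    intro b h1 h2
    rw [← wdet_succ_row, hF _ _ h1 h2]
  obtain ⟨d, hd0, hd⟩ : ∃ d : Fin (k + 1) → K, d 0 = (-1) ^ k ∧
      ∀ j, ∑ i, d i * R (a - h + 1) i j = 0 := by
    let B : Matrix (Fin k) (Fin k) K := Matrix.of fun i j : Fin k => R (a - h + 1) i.succ j
    have hB : IsUnit B.det := by
      rw [hbot _ (by omega) (by omega)]; exact isUnit_one
    let v : Fin k → K := fun j => - ((-1) ^ k * R (a - h + 1) 0 j)
    refine ⟨Fin.cons ((-1) ^ k) (Matrix.vecMul v B⁻¹), rfl, ?_⟩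
    intro j
    have : Matrix.vecMul (Matrix.vecMul v B⁻¹) B = v := by
      rw [Matrix.vecMul_vecMul, Matrix.nonsing_inv_mul _ hB, Matrix.vecMul_one]
    have := congrFun this j
    rw [Fin.sum_univ_succ]
    simp only [Fin.cons_zero, Fin.cons_succ]
    have h2 : Matrix.vecMul (Matrix.vecMul v B⁻¹) B j =
      ∑ i : Fin k, Matrix.vecMul v B⁻¹ i * R (a - h + 1) i.succ j := rfl
    rw [← h2, this]
    simp [v]
  have key : ∀ m : ℕ, m < h → ∀ c : ℤ, a - h < c → c ≤ a - h + k + m →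
      ∑ i : Fin (k + 1), d i * C (a + ((i : ℕ) : ℤ)) c = 0 := by
    intro m
    induction m with
    | zero =>
      intro _ c h1 h2
      have := hd ⟨(c - (a - h + 1)).toNat, by omega⟩
      simp only [R] at this
      rw [show a - h + 1 + (((c - (a - h + 1)).toNat : ℕ) : ℤ) = c by omega] at this
      exact this
    | succ m ih =>
      intro hm c h1 h2
      have ih := ih (by omega)
      by_cases hc : c ≤ a - h + k + m
      · exact ih c h1 hc
      have hc' : c = (a - h + 1 + m) + k := by push_cast at h2; omega
      have hz := hF' a (a - h + 1 + m) (by omega) (by omega)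
      unfold wdet at hz
      rw [← Matrix.exists_vecMul_eq_zero_iff] at hz
      obtain ⟨e, he, hz⟩ := hz
      have hz : ∀ j : Fin (k + 1), ∑ i : Fin (k + 1), e i *
        C (a + ((i : ℕ) : ℤ)) (a - h + 1 + m + ((j : ℕ) : ℤ)) = 0 := fun j => congrFun hz j
      have hdet := hbot (a - h + 1 + m) (by omega) (by omega)
      have heR : ∀ j, ∑ i, e i * R (a - h + 1 + m) i j = 0 := fun j => hz j.castSucc
      have hdR : ∀ j, ∑ i, d i * R (a - h + 1 + m) i j = 0 := by
        intro j
        have := j.2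
        exact ih _ (by omega) (by omega)
      have he0 : e 0 ≠ 0 := fun h0 => he (relB _ e h0 heR (by rw [hdet]; exact one_ne_zero))
      have hf := relB (R (a - h + 1 + m)) (fun i => e 0 * d i - d 0 * e i) (by ring)
        (by
          intro j
          simp only [sub_mul, Finset.sum_sub_distrib, mul_assoc, ← Finset.mul_sum, heR, hdR]
          simp) (by rw [hdet]; exact one_ne_zero)
      have hf' : ∀ i, e 0 * d i = d 0 * e i := fun i => sub_eq_zero.mp (congrFun hf i)
      have hl := hz (Fin.last k)
      rw [Fin.val_last, ← hc'] at hl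
      have : e 0 * ∑ i : Fin (k + 1), d i * C (a + ((i : ℕ) : ℤ)) c = 0 := by
        rw [Finset.mul_sum]
        simp only [← mul_assoc, hf']
        simp only [mul_assoc, ← Finset.mul_sum, hl, mul_zero]
      exact (mul_eq_zero.mp this).resolve_left he0
  refine ⟨d, hd0, ?_, ?_⟩
  · have hdn : d ≠ 0 := by
      intro h0
      rw [h0] at hd0
      exact pow_ne_zero k (neg_ne_zero.mpr (one_ne_zero (α := K))) hd0.symm
    have := relA (R (a - h + 1)) d hdn hd
    rw [hbot _ (by omega) (by omega)] at this
    have ht : Matrix.det (Matrix.of fun i j : Fin k => R (a - h + 1) i.castSucc j) = 1 :=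
      hF a (a - h + 1) (by omega) (by omega)
    rw [ht, hd0, ← mul_pow] at this
    simpa using this
  · intro c h1 h2
    exact key (h - 1) (by omega) c h1 (by omega)

theorem frieze_of_killer {k h : ℕ} {C : ℤ → ℤ → K}
    (hC : IsPrefriezeH h C) (hK : ∀ a, ∃ d, Killer C k h a d) :
    (∀ a b : ℤ, b ≤ a → a ≤ b + h → wdet C k a b = 1) ∧
    (∀ a b : ℤ, b < a → a < b + h → wdet C (k + 1) a b = 0) := by
  have hne : ∀ a d, Killer C k h a d → d ≠ 0 := by
    intro a d hd h0
    have := hd.2.1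
    rw [h0] at this
    exact zero_ne_one this
  constructor
  · intro a b h1 h2
    obtain ⟨n, rfl⟩ : ∃ n : ℕ, a = b + n := ⟨(a - b).toNat, by omega⟩
    clear h1
    induction n with
    | zero => simpa using wdet_diag hC k b
    | succ n ih =>
      have ih := ih (by push_cast at h2; omega)
      obtain ⟨d, hd⟩ := hK (b + n)
      have := relA (fun (i : Fin (k + 1)) (j : Fin k) =>
        C (b + n + ((i : ℕ) : ℤ)) (b + ((j : ℕ) : ℤ))) d (hne _ _ hd)
        (by intro j; have := j.2; exact hd.2.2 _ (by push_cast at h2; omega) (by omega))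
      rw [← wdet_succ_row, hd.1, hd.2.1, ← mul_pow] at this
      push_cast
      rw [← add_assoc]
      simp only [mul_neg, mul_one, neg_neg, one_pow, one_mul] at this
      rw [this]
      exact ih
  · intro a b h1 h2
    obtain ⟨d, hd⟩ := hK a
    unfold wdet
    rw [← Matrix.exists_vecMul_eq_zero_iff]
    refine ⟨d, hne _ _ hd, ?_⟩
    ext j
    have := j.2
    exact hd.2.2 _ (by omega) (by omega)

/-- Pairing of a row combination with a solution. -/
theorem pair_zero {k h : ℕ} {C : ℤ → ℤ → K} (hC : IsPrefriezeH h C) (d : Fin (k + 1) → K)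
    (a : ℤ) (x : ℤ → K) (hx : SolvesRec C x) :
    ∑ c ∈ Finset.Icc (a - h) (a + k),
      (∑ i : Fin (k + 1), d i * C (a + ((i : ℕ) : ℤ)) c) * x c = 0 := by
  simp only [Finset.sum_mul]
  rw [Finset.sum_comm]
  apply Finset.sum_eq_zero
  intro i _
  have := i.2
  simp only [mul_assoc]
  rw [← Finset.mul_sum, ← row_sum hC x _ _ _ (by omega) (by omega), hx, mul_zero]

theorem period_of_killer {k h : ℕ} (hk : 0 < k) (hh : 0 < h) {C : ℤ → ℤ → K}
    (hC : IsPrefriezeH h C) (a : ℤ) (d) (hd : Killer C k h a d) (x : ℤ → K)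
    (hx : SolvesRec C x) : x (a + k) = (-1 : K) ^ (k - 1) * x (a - h) := by
  have h0 := pair_zero hC d a x hx
  obtain ⟨e1, e2⟩ := end_cols hC d a hk hh
  rw [Finset.sum_eq_add_of_mem (a - h) (a + k) (by simp; omega) (by simp; omega) (by omega),
    e1, e2, hd.1, hd.2.1] at h0
  · obtain ⟨m, rfl⟩ : ∃ m, k = m + 1 := ⟨k - 1, by omega⟩
    rw [pow_succ] at h0
    simp only [Nat.add_sub_cancel]
    linear_combination h0
  · intro c hc hne
    simp only [Finset.mem_Icc] at hc
    rw [hd.2.2 c (by omega) (by omega), zero_mul]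

theorem killer_of_period {k h : ℕ} (hk : 0 < k) (hh : 0 < h) {C : ℤ → ℤ → K}
    (hC : IsPrefriezeH h C) (a : ℤ)
    (hP : ∀ x, SolvesRec C x → x (a + k) = (-1 : K) ^ (k - 1) * x (a - h)) :
    ∃ d, Killer C k h a d := by
  let M : Matrix (Fin (k + 1)) (Fin (k + 1)) K :=
    Matrix.of fun i j => C (a + ((i : ℕ) : ℤ)) (a + ((j : ℕ) : ℤ))
  have hM : IsUnit M.det := by
    have : M.det = 1 := wdet_diag hC (k + 1) a
    rw [this]; exact isUnit_one
  let v : Fin (k + 1) → K := Pi.single (Fin.last k) 1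
  let d := Matrix.vecMul v M⁻¹
  have hdM : Matrix.vecMul d M = v := by
    simp only [d]
    rw [Matrix.vecMul_vecMul, Matrix.nonsing_inv_mul _ hM, Matrix.vecMul_one]
  have hd : ∀ j : Fin (k + 1), ∑ i : Fin (k + 1), d i *
      C (a + ((i : ℕ) : ℤ)) (a + ((j : ℕ) : ℤ)) = v j := fun j => congrFun hdM j
  obtain ⟨e1, e2⟩ := end_cols hC d a hk hh
  have hlast : d (Fin.last k) = 1 := by
    rw [← e2]
    have := hd (Fin.last k)
    rw [Fin.val_last] at this
    rw [this]; simp [v]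
  have hmid : ∀ c : ℤ, a ≤ c → c < a + k →
      ∑ i : Fin (k + 1), d i * C (a + ((i : ℕ) : ℤ)) c = 0 := by
    intro c h1 h2
    have := hd ⟨(c - a).toNat, by omega⟩
    simp only at this
    rw [show a + (((c - a).toNat : ℕ) : ℤ) = c by omega] at this
    rw [this]
    simp only [v]
    rw [Pi.single_eq_of_ne]
    intro h
    have := congrArg Fin.val h
    simp only [Fin.val_last] at this
    omega
  have hlow : ∀ c : ℤ, a - h ≤ c → c < a →
      ∑ i : Fin (k + 1), d i * C (a + ((i : ℕ) : ℤ)) c =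
        if c = a - h then (-1) ^ k else 0 := by
    intro c h1 h2
    obtain ⟨x, hx, hxy⟩ := exists_sol hC a (fun t => if t = c then 1 else 0)
    have h0 := pair_zero hC d a x hx
    have hp := hP x hx
    rw [hxy (a - h) (by omega) (by omega)] at hp
    rw [Finset.sum_eq_add_of_mem c (a + k) (by simp; omega) (by simp; omega) (by omega),
      e2, hlast, hxy c h1 h2, hp] at h0
    · obtain ⟨m, rfl⟩ : ∃ m, k = m + 1 := ⟨k - 1, by omega⟩
      simp only [Nat.add_sub_cancel, if_true] at h0
      by_cases hc : c = a - h
      · rw [if_pos hc.symm] at h0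
        rw [if_pos hc, pow_succ]
        linear_combination h0
      · rw [if_neg (Ne.symm hc)] at h0
        rw [if_neg hc]
        linear_combination h0
    · intro t ht hne
      simp only [Finset.mem_Icc] at ht
      by_cases hta : t < a
      · rw [hxy t (by omega) hta, if_neg hne.1, mul_zero]
      · rw [hmid t (by omega) (by omega), zero_mul]
  refine ⟨d, ?_, hlast, ?_⟩
  · rw [← e1, hlow _ le_rfl (by omega), if_pos rfl]
  · intro c h1 h2
    by_cases hc : c < a
    · rw [hlow c (by omega) hc, if_neg (by omega)]
    · exact hmid c (by omega) h2

/-- **`SL(k)`-friezes as linear recurrences.** A prefrieze `C` of height `h` is an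
`SL(k)`-frieze iff every solution `x` of `C x = 0` satisfies
`x (a+h+k) = (-1)^(k-1) * x a` for all `a`. -/
theorem slFrieze_iff_superperiodic (k h : ℕ) (hk : 0 < k) (hh : 0 < h)
    (C : ℤ → ℤ → K) (hC : IsPrefriezeH h C) :
    IsSLFrieze k h C ↔
      ∀ x : ℤ → K, SolvesRec C x →
        ∀ a : ℤ, x (a + h + k) = (-1 : K) ^ (k - 1) * x a := by
  unfold IsSLFrieze
  simp only [minor_eq_wdet, minor_eq_wdet']
  constructor
  · rintro ⟨-, hF, hF'⟩ x hx a
    obtain ⟨d, hd⟩ := killer_of_frieze hh hF hF' (a + h)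
    have := period_of_killer hk hh hC (a + h) d hd x hx
    rwa [add_sub_cancel_right] at this
  · intro hP
    refine ⟨hC, frieze_of_killer hC fun a => killer_of_period hk hh hC a fun x hx => ?_⟩
    have := hP x hx (a - h)
    rwa [sub_add_cancel] at this
end
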